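/- arXiv:alg-geom/9705013 — 2 statements merged into one kernel-verified Lean document; each statement's English description precedes it below -/
import Mathlib

section
/- Let u, w ∈ S_∞ and k ∈ ℕ. Then u ≤_k w in the k-Bruhat order if and only if both of the following hold: (I) for every a ≤ k one has u(a) ≤ w(a), and for every b > k one has u(b) ≥ w(b); (II) whenever a < b with u(a) < u(b) and w(a) > w(b), one has a ≤ k < b. -/
/-- A permutation of the positive integers belongs to `S_∞` when it moves only
finitely many points. -/
def FinSupp (w : Equiv.Perm ℕ+) : Prop := {x : ℕ+ | w x ≠ x}.Finite

/-- The length `ℓ(w)` of a permutation: its number of inversions, i.e. of pairs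
`i < j` with `w i > w j`. -/
noncomputable def len (w : Equiv.Perm ℕ+) : ℕ :=
  Set.ncard {p : ℕ+ × ℕ+ | p.1 < p.2 ∧ w p.2 < w p.1}

/-- Covering relation of the `k`-Bruhat order: `u ⋖_k u(a,b)` for `a ≤ k < b`
with `ℓ(u(a,b)) = ℓ(u) + 1`.  Here `u(a,b) = u * (swap a b)`. -/
def kBruhatCov (k : ℕ+) (u w : Equiv.Perm ℕ+) : Prop :=
  ∃ a b : ℕ+, a ≤ k ∧ k < b ∧ w = u * Equiv.swap a b ∧ len w = len u + 1

/-- The `k`-Bruhat order `u ≤_k w`: a chain of `k`-Bruhat covers from `u` to `w`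
(or `u = w`). -/
def kBruhat (k : ℕ+) : Equiv.Perm ℕ+ → Equiv.Perm ℕ+ → Prop :=
  Relation.ReflTransGen (kBruhatCov k)

open Equiv

lemma eq_or_apply_lt_or_gt (w : Perm ℕ+) (x y : ℕ+) : x = y ∨ w x < w y ∨ w y < w x :=
  or_iff_not_imp_left.mpr fun h => lt_or_gt_of_ne (w.injective.ne h)

/-- The inversions of a permutation, as pairs of positions. -/
def inversions (w : Perm ℕ+) : Set (ℕ+ × ℕ+) :=
  {p | p.1 < p.2 ∧ w p.2 < w p.1}

lemma FinSupp.finite_inversions {w : Perm ℕ+} (hw : FinSupp w) : (inversions w).Finite := by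
  obtain ⟨N, hN⟩ := hw.bddAbove
  have hfix : ∀ x, N < x → w x = x := fun x hx => by
    by_contra h
    exact absurd (hN h) (not_le.mpr hx)
  refine ((Set.finite_Iic N).prod (Set.finite_Iic N)).subset ?_
  rintro ⟨i, j⟩ ⟨hij, hw'⟩
  have hj : j ≤ N := by
    by_contra! h
    have hwj := hfix j h
    simp only [hwj] at hw'
    have := w.injective (hfix (w i) (h.trans hw'))
    rw [this] at hw'
    exact lt_asymm hij hw'
  exact ⟨hij.le.trans hj, hj⟩

lemma FinSupp.mul_swap {w : Perm ℕ+} (hw : FinSupp w) (a b : ℕ+) :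
    FinSupp (w * swap a b) := by
  refine (hw.union (Set.toFinite {a, b})).subset fun x hx => ?_
  by_contra h
  simp only [Set.mem_union, Set.mem_ofPred_eq, Set.mem_insert_iff, Set.mem_singleton_iff] at h hx
  push Not at h
  exact hx (by rw [Perm.mul_apply, swap_apply_of_ne_of_ne h.2.1 h.2.2, h.1])

/-- Transport of position pairs along `swap a b`, leaving alone the pairs whose order it reverses. -/
def swapPair (a b : ℕ+) (p : ℕ+ × ℕ+) : ℕ+ × ℕ+ :=
  if swap a b p.1 < swap a b p.2 then (swap a b p.1, swap a b p.2) else p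

lemma injOn_swapPair (a b : ℕ+) : Set.InjOn (swapPair a b) {p | p.1 < p.2} := by
  rintro ⟨i, j⟩ hij ⟨i', j'⟩ hij' h
  simp only [Set.mem_ofPred_eq] at hij hij'
  unfold swapPair at h
  split_ifs at h with h1 h2 h2 <;> simp only [Prod.mk.injEq] at h h1 h2 ⊢
  · simpa using h
  · rw [← h.1, ← h.2] at h2
    simp [hij] at h2
  · rw [h.1, h.2] at h1
    simp [hij'] at h1
  · exact h

lemma swap_lt_swap_iff {a b i j : ℕ+} (hab : a < b) (hij : i < j) :
    swap a b i < swap a b j ↔ ¬ (i = a ∧ j ≤ b ∨ a ≤ i ∧ j = b) := by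
  simp only [swap_apply_def]
  split_ifs <;> grind

lemma swapPair_image_subset {u : Perm ℕ+} {a b : ℕ+} (hab : a < b) (h : u a < u b) :
    swapPair a b '' inversions u ⊆ inversions (u * swap a b) \ {(a, b)} := by
  rintro _ ⟨⟨i, j⟩, ⟨hij, hu⟩, rfl⟩
  simp only at hij hu
  unfold swapPair
  split_ifs with h1 <;> simp only at h1
  · refine ⟨⟨h1, by simpa using hu⟩, ?_⟩
    simp only [Set.mem_singleton_iff, Prod.mk.injEq, not_and]
    intro h2 h3
    rw [swap_apply_eq_iff, swap_apply_left] at h2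
    rw [swap_apply_eq_iff, swap_apply_right] at h3
    subst h2 h3
    exact lt_asymm hij hab
  · rw [swap_lt_swap_iff hab hij] at h1
    simp only [inversions, Set.mem_sdiff, Set.mem_ofPred_eq, Perm.mul_apply, swap_apply_def,
      Set.mem_singleton_iff, Prod.mk.injEq]
    grind

lemma len_eq_ncard_swapPair_image (u : Perm ℕ+) (a b : ℕ+) :
    len u = (swapPair a b '' inversions u).ncard :=
  ((injOn_swapPair a b).mono fun _ hp => hp.1).ncard_image.symm

lemma len_lt_len_mul_swap {u : Perm ℕ+} (hu : FinSupp u) {a b : ℕ+} (hab : a < b)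
    (h : u a < u b) : len u < len (u * swap a b) := by
  rw [len_eq_ncard_swapPair_image u a b]
  refine Set.ncard_lt_ncard ?_ (hu.mul_swap a b).finite_inversions
  refine (swapPair_image_subset hab h).trans_ssubset (Set.sdiff_singleton_ssubset.mpr ?_)
  exact ⟨hab, by simpa using h⟩

lemma len_mul_swap_eq_succ {u : Perm ℕ+} (hu : FinSupp u) {a b : ℕ+} (hab : a < b)
    (h : u a < u b) (hc : ∀ c, a < c → c < b → u a < u c → ¬ u c < u b) :
    len (u * swap a b) = len u + 1 := by
  have key : inversions (u * swap a b) = insert (a, b) (swapPair a b '' inversions u) := by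
    apply Set.Subset.antisymm
    · rintro ⟨i, j⟩ ⟨hij, hv⟩
      simp only at hij hv
      by_cases h1 : swap a b i < swap a b j
      · refine Or.inr ⟨(swap a b i, swap a b j), ⟨h1, hv⟩, ?_⟩
        simp [swapPair, hij]
      · by_cases h2 : i = a ∧ j = b
        · exact Or.inl (Prod.ext h2.1 h2.2)
        · refine Or.inr ⟨(i, j), ⟨hij, ?_⟩, by simp [swapPair, h1]⟩
          rw [swap_lt_swap_iff hab hij] at h1
          have hinj := eq_or_apply_lt_or_gt u
          simp only [Perm.mul_apply, swap_apply_def] at hv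
          simp only
          grind
    · rintro _ (rfl | hp)
      · exact ⟨hab, by simpa using h⟩
      · exact (swapPair_image_subset hab h hp).1
  rw [len_eq_ncard_swapPair_image u a b]
  change (inversions _).ncard = _
  rw [key, Set.ncard_insert_of_notMem (fun hm => (swapPair_image_subset hab h hm).2 rfl)
    (hu.finite_inversions.image _)]

lemma len_add_two_le_len_mul_swap {u : Perm ℕ+} (hu : FinSupp u) {a b c : ℕ+} (hac : a < c)
    (hcb : c < b) (h1 : u a < u c) (h2 : u c < u b) : len u + 2 ≤ len (u * swap a b) := by
  have hab := hac.trans hcb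
  have h := h1.trans h2
  have hne : ((a, b) : ℕ+ × ℕ+) ≠ (a, c) := fun e => hcb.ne' (Prod.ext_iff.mp e).2
  have hmem : (a, c) ∉ swapPair a b '' inversions u := by
    rintro ⟨⟨i, j⟩, ⟨hij, hu'⟩, he⟩
    simp only at hij hu'
    unfold swapPair at he
    split_ifs at he with h3 <;> simp only [Prod.mk.injEq] at he h3
    · obtain ⟨hi, hj⟩ := he
      rw [swap_apply_eq_iff, swap_apply_left] at hi
      rw [swap_apply_eq_iff, swap_apply_of_ne_of_ne hac.ne' hcb.ne] at hj
      subst hi hj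
      exact lt_asymm hij hcb
    · obtain ⟨rfl, rfl⟩ := he
      exact lt_asymm hu' h1
  have hfin := hu.finite_inversions.image (swapPair a b)
  have hcard : (insert (a, b) (insert (a, c) (swapPair a b '' inversions u))).ncard =
      len u + 2 := by
    rw [Set.ncard_insert_of_notMem _ (hfin.insert _), Set.ncard_insert_of_notMem hmem hfin,
      ← len_eq_ncard_swapPair_image]
    rintro (he | hm)
    · exact hne he
    · exact (swapPair_image_subset hab h hm).2 rfl
  rw [← hcard]
  refine Set.ncard_le_ncard ?_ (hu.mul_swap a b).finite_inversions
  rintro _ (rfl | rfl | hp)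
  · exact ⟨hab, by simpa using h⟩
  · exact ⟨hac, by simpa [swap_apply_of_ne_of_ne hac.ne' hcb.ne] using h2⟩
  · exact (swapPair_image_subset hab h hp).1

lemma len_mul_swap_eq_succ_iff {u : Perm ℕ+} (hu : FinSupp u) {a b : ℕ+} (hab : a < b) :
    len (u * swap a b) = len u + 1 ↔
      u a < u b ∧ ∀ c, a < c → c < b → u a < u c → ¬ u c < u b := by
  refine ⟨fun hlen => ?_, fun h => len_mul_swap_eq_succ hu hab h.1 h.2⟩
  have h : u a < u b := by
    refine (le_of_not_gt fun hba => ?_).lt_of_ne (u.injective.ne hab.ne)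
    have := len_lt_len_mul_swap (hu.mul_swap a b) hab (by simpa using hba)
    rw [mul_assoc, swap_mul_self, mul_one] at this
    omega
  refine ⟨h, fun c hac hcb h1 h2 => ?_⟩
  have := len_add_two_le_len_mul_swap hu hac hcb h1 h2
  omega

/-- If some position falls below the threshold `m` on passing from `u` to `w`, then some position
rises above it. -/
lemma exists_lt_and_le_of_exists {u w : Perm ℕ+} {m b : ℕ+} (hw : w b < m) (hu : m ≤ u b) :
    ∃ a, u a < m ∧ m ≤ w a := by
  by_contra! h
  have hfin : (w ⁻¹' Set.Iio m).Finite := (Set.finite_Iio m).preimage w.injective.injOn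
  have hcard : ∀ v : Perm ℕ+, (v ⁻¹' Set.Iio m).ncard = (Set.Iio m).ncard := fun v =>
    Set.ncard_preimage_of_injective_subset_range v.injective (by simp)
  have heq : u ⁻¹' Set.Iio m = w ⁻¹' Set.Iio m :=
    Set.eq_of_subset_of_ncard_le (fun a ha => h a ha) (by rw [hcard, hcard]) hfin
  have hb : b ∈ u ⁻¹' Set.Iio m := heq ▸ hw
  exact absurd hb (not_lt.mpr hu)

/-- The two conditions characterising the `k`-Bruhat order, with the second one stated as
preservation of the order on either side of `k`. -/
structure KBruhatCond (k : ℕ+) (u w : Perm ℕ+) : Prop where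
  le : ∀ a, a ≤ k → u a ≤ w a
  ge : ∀ b, k < b → w b ≤ u b
  left : ∀ a b, a < b → b ≤ k → u a < u b → w a < w b
  right : ∀ a b, a < b → k < a → u a < u b → w a < w b

lemma KBruhatCond.refl (k : ℕ+) (u : Perm ℕ+) : KBruhatCond k u u :=
  ⟨fun _ _ => le_rfl, fun _ _ => le_rfl, fun _ _ _ _ h => h, fun _ _ _ _ h => h⟩

lemma KBruhatCond.trans {k : ℕ+} {u v w : Perm ℕ+} (h₁ : KBruhatCond k u v)
    (h₂ : KBruhatCond k v w) : KBruhatCond k u w :=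
  ⟨fun a ha => (h₁.le a ha).trans (h₂.le a ha), fun b hb => (h₂.ge b hb).trans (h₁.ge b hb),
    fun a b hab hb h => h₂.left a b hab hb (h₁.left a b hab hb h),
    fun a b hab ha h => h₂.right a b hab ha (h₁.right a b hab ha h)⟩

lemma kBruhatCov.cond {k : ℕ+} {u w : Perm ℕ+} (hu : FinSupp u) (h : kBruhatCov k u w) :
    KBruhatCond k u w := by
  obtain ⟨a, b, ha, hb, rfl, hlen⟩ := h
  obtain ⟨hlt, hc⟩ := (len_mul_swap_eq_succ_iff hu (ha.trans_lt hb)).mp hlen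
  have hinj := eq_or_apply_lt_or_gt u
  constructor <;> simp only [Perm.mul_apply, swap_apply_def] <;> grind

lemma kBruhat.finSupp_and_cond {k : ℕ+} {u w : Perm ℕ+} (hu : FinSupp u) (h : kBruhat k u w) :
    FinSupp w ∧ KBruhatCond k u w := by
  induction h with
  | refl => exact ⟨hu, .refl k u⟩
  | tail _ hcov ih =>
    refine ⟨?_, ih.2.trans (hcov.cond ih.1)⟩
    obtain ⟨a, b, -, -, rfl, -⟩ := hcov
    exact ih.1.mul_swap a b

lemma KBruhatCond.exists_lt {k : ℕ+} {u w : Perm ℕ+} (h : KBruhatCond k u w) (hne : u ≠ w) :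
    ∃ a, a ≤ k ∧ u a < w a := by
  obtain ⟨x, hx⟩ := DFunLike.ne_iff.mp hne
  rcases le_or_gt x k with hk | hk
  · exact ⟨x, hk, (h.le x hk).lt_of_ne hx⟩
  · obtain ⟨a, h1, h2⟩ := exists_lt_and_le_of_exists ((h.ge x hk).lt_of_ne' hx) le_rfl
    have hlt := h1.trans_le h2
    exact ⟨a, not_lt.mp fun hka => (h.ge a hka).not_gt hlt, hlt⟩

/-- Two distinct permutations satisfying the conditions can be brought closer by a cover
below the upper one. -/
lemma KBruhatCond.exists_cov {k : ℕ+} {u w : Perm ℕ+} (hw : FinSupp w) (h : KBruhatCond k u w)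
    (hne : u ≠ w) : ∃ v, FinSupp v ∧ KBruhatCond k u v ∧ kBruhatCov k v w := by
  obtain ⟨a, ⟨hak, ha⟩, hmin⟩ := Set.exists_min_image {a | a ≤ k ∧ u a < w a} u
    ((Set.finite_Iic k).subset fun _ h => h.1) (h.exists_lt hne)
  have hnonempty : {b | k < b ∧ w b < w a ∧ w a ≤ u b}.Nonempty := by
    obtain ⟨b, h1, h2⟩ := exists_lt_and_le_of_exists (u := w) (w := u) ha le_rfl
    exact ⟨b, not_le.mp fun hb => (h.le b hb).not_gt (h1.trans_le h2), h1, h2⟩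
  obtain ⟨b, ⟨hkb, hb, hab⟩, hmax⟩ := Set.exists_max_image
    {b | k < b ∧ w b < w a ∧ w a ≤ u b} u
    (((Set.finite_Iio (w a)).preimage w.injective.injOn).subset fun _ h => h.2.1) hnonempty
  have hba : u a ≤ w b := by
    by_contra! hlt
    obtain ⟨c, h1, h2⟩ := exists_lt_and_le_of_exists hlt (ha.le.trans hab)
    have hc : c ≤ k := not_lt.mp fun hc => (h.ge c hc).not_gt (h1.trans_le h2)
    exact (hmin c ⟨hc, h1.trans_le h2⟩).not_gt h1
  have hlt := hak.trans_lt hkb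
  have hinju := eq_or_apply_lt_or_gt u
  have hinjw := eq_or_apply_lt_or_gt w
  obtain ⟨hle, hge, hleft, hright⟩ := h
  simp only [Set.mem_ofPred_eq, and_imp] at hmin hmax
  have hww : w = w * swap a b * swap a b := by rw [mul_assoc, swap_mul_self, mul_one]
  refine ⟨w * swap a b, hw.mul_swap a b, ?_, a, b, hak, hkb, hww, ?_⟩
  · constructor <;> simp only [Perm.mul_apply, swap_apply_def]
    · grind
    · grind
    · intro i j hij hj hu
      have := hleft i j hij hj hu
      have := hle i
      have := hmin i
      grind
    · intro i j hij hi hu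
      have := hright i j hij hi hu
      have := hge j
      have := hmax j
      grind
  · conv_lhs => rw [hww]
    refine (len_mul_swap_eq_succ_iff (hw.mul_swap a b) hlt).mpr ⟨by simpa using hb, ?_⟩
    intro c hac hcb
    rw [Perm.mul_apply, Perm.mul_apply, Perm.mul_apply, swap_apply_left, swap_apply_right,
      swap_apply_of_ne_of_ne hac.ne' hcb.ne]
    intro h1 h2
    rcases le_or_gt c k with hc | hc
    · have := hleft a c hac hc
      have := hmin c hc
      grind
    · have := hright c b hcb hc
      have := hmax c hc
      grind

lemma KBruhatCond.kBruhat {k : ℕ+} {u w : Perm ℕ+} (hw : FinSupp w) (h : KBruhatCond k u w) :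
    kBruhat k u w := by
  induction hn : len w using Nat.strong_induction_on generalizing w with
  | _ n ih =>
    by_cases hne : u = w
    · exact hne ▸ Relation.ReflTransGen.refl
    · obtain ⟨v, hv, hcond, hcov⟩ := h.exists_cov hw hne
      have hlen : len w = len v + 1 := hcov.choose_spec.choose_spec.2.2.2
      exact (ih (len v) (by omega) hv hcond rfl).tail hcov

lemma kBruhatCond_iff {k : ℕ+} {u w : Perm ℕ+} :
    KBruhatCond k u w ↔
      ((∀ a : ℕ+, a ≤ k → u a ≤ w a) ∧ (∀ b : ℕ+, k < b → w b ≤ u b) ∧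
        (∀ a b : ℕ+, a < b → u a < u b → w b < w a → a ≤ k ∧ k < b)) := by
  refine ⟨fun ⟨h1, h2, h3, h4⟩ => ⟨h1, h2, fun a b hab hu hw => ⟨?_, ?_⟩⟩,
    fun ⟨h1, h2, h3⟩ => ⟨h1, h2, fun a b hab hb hu => ?_, fun a b hab ha hu => ?_⟩⟩
  · exact not_lt.mp fun ha => (h4 a b hab ha hu).not_gt hw
  · exact not_le.mp fun hb => (h3 a b hab hb hu).not_gt hw
  · exact (not_lt.mp fun hlt => (h3 a b hab hu hlt).2.not_ge hb).lt_of_ne (w.injective.ne hab.ne)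
  · exact (not_lt.mp fun hlt => (h3 a b hab hu hlt).1.not_gt ha).lt_of_ne (w.injective.ne hab.ne)

/-- Theorem (characterisation of the `k`-Bruhat order): `u ≤_k w` iff
(I) `u(a) ≤ w(a)` for `a ≤ k` and `u(b) ≥ w(b)` for `b > k`, and
(II) `a < b`, `u(a) < u(b)`, `w(a) > w(b)` imply `a ≤ k < b`. -/
theorem stmt_0 (k : ℕ+) (u w : Equiv.Perm ℕ+) (hu : FinSupp u) (hw : FinSupp w) :
    kBruhat k u w ↔
      ((∀ a : ℕ+, a ≤ k → u a ≤ w a) ∧ (∀ b : ℕ+, k < b → w b ≤ u b) ∧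
        (∀ a b : ℕ+, a < b → u a < u b → w b < w a → a ≤ k ∧ k < b)) := by
  rw [← kBruhatCond_iff]
  exact ⟨fun h => (kBruhat.finSupp_and_cond hu h).2, fun h => h.kBruhat hw⟩
end

section
/- Let k ∈ ℕ and let u, w ∈ S_∞ with u ≠ w satisfy: (I) for every a ≤ k, u(a) ≤ w(a), and for every b > k, u(b) ≥ w(b); (II) whenever a < b with u(a) < u(b) and w(a) > w(b), one has a ≤ k < b. Then: (1) there exists a ≤ k with u(a) < w(a); fix a ≤ k with u(a) minimal subject to u(a) < w(a); (2) there exists b > k with w(b) < w(a) ≤ u(b); fix b > k with u(b) maximal subject to w(b) < w(a) ≤ u(b). For these a and b, ℓ(w(a,b)) = ℓ(w) − 1 (so w(a,b) ⋖_k w is a cover in the k-Bruhat order), and the pair (u, w(a,b)) again satisfies conditions (I) and (II). -/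
/-- Two permutations have equally many values below `m`, so a position where `w` is below `m`
and `u` is not forces a position of the opposite kind. -/
theorem exists_lt_of_lt (u w : Equiv.Perm ℕ+) {m y : ℕ+} (hw : w y < m) (hu : m ≤ u y) :
    ∃ x, u x < m ∧ m ≤ w x := by
  by_contra! h
  have hsub : (Finset.Ico 1 m).map u.symm.toEmbedding ⊆
      (Finset.Ico 1 m).map w.symm.toEmbedding := by
    intro x hx
    simp only [Finset.mem_map_equiv, Equiv.symm_symm, Finset.mem_Ico, one_le,
      true_and] at hx ⊢
    exact h x hx
  have heq := Finset.eq_of_subset_of_card_le hsub (by simp only [Finset.card_map, le_refl])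
  have hy : y ∈ (Finset.Ico 1 m).map w.symm.toEmbedding := by
    simpa [Finset.mem_map_equiv] using hw
  rw [← heq] at hy
  have : u y < m := by simpa [Finset.mem_map_equiv] using hy
  exact absurd this (not_lt.mpr hu)

theorem FinSupp.finite_inversions_s2 {w : Equiv.Perm ℕ+} (hw : FinSupp w) :
    {p : ℕ+ × ℕ+ | p.1 < p.2 ∧ w p.2 < w p.1}.Finite := by
  obtain ⟨N, hN⟩ := Set.Finite.bddAbove hw
  refine ((Set.finite_Icc 1 N).prod (Set.finite_Icc 1 N)).subset ?_
  rintro ⟨i, j⟩ ⟨hij, hwij⟩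
  dsimp only at hij hwij
  have hfix : ∀ x, N < x → w x = x := fun x hx => by
    by_contra hne
    exact absurd (hN hne) (not_le.mpr hx)
  have hj : j ≤ N := by
    by_contra! hlt
    rw [hfix j hlt] at hwij
    have := w.injective (hfix (w i) (hlt.trans hwij))
    exact absurd (this ▸ hwij) (not_lt.mpr hij.le)
  exact ⟨⟨one_le, hij.le.trans hj⟩, one_le, hj⟩

/-- If no position strictly between `a` and `b` carries a value strictly between `w b` and `w a`,
then removing the inversion `(a, b)` decreases the length by exactly one. -/
theorem len_mul_swap {w : Equiv.Perm ℕ+} (hw : FinSupp w) {a b : ℕ+} (hab : a < b)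
    (hwab : w b < w a) (hbtw : ∀ c, a < c → c < b → w b < w c → w a ≤ w c) :
    len (w * Equiv.swap a b) + 1 = len w := by
  set s := Equiv.swap a b with hs
  have hss : ∀ x, s (s x) = x := Equiv.swap_apply_self a b
  have hbtw' : ∀ c, a < c → c < b → w c < w b ∨ w a < w c := fun c h₁ h₂ => by
    rcases lt_trichotomy (w c) (w b) with h | h | h
    · exact .inl h
    · exact absurd (w.injective h) h₂.ne
    · exact .inr (lt_of_le_of_ne (hbtw c h₁ h₂ h) fun h' => h₁.ne (w.injective h'))
  have hcase : ∀ i j, i < j → ¬ s i < s j →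
      (i = a ∧ j = b) ∨ (i = a ∧ a < j ∧ j < b ∧ s j = j) ∨
        (j = b ∧ a < i ∧ i < b ∧ s i = i) := by
    intro i j hij h
    simp only [hs, Equiv.swap_apply_def] at h ⊢
    grind
  have hsa : s a = b := Equiv.swap_apply_left a b
  have hsb : s b = a := Equiv.swap_apply_right a b
  let f : ℕ+ × ℕ+ → ℕ+ × ℕ+ := fun p => if s p.1 < s p.2 then (s p.1, s p.2) else p
  have hff : ∀ p : ℕ+ × ℕ+, p.1 < p.2 → f (f p) = p := by
    intro p hp
    by_cases h : s p.1 < s p.2 <;> simp [f, h, hss, hp]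
  have hmem : (a, b) ∈ {p : ℕ+ × ℕ+ | p.1 < p.2 ∧ w p.2 < w p.1} := ⟨hab, hwab⟩
  have hto : ∀ p : ℕ+ × ℕ+, p.1 < p.2 → (w * s) p.2 < (w * s) p.1 →
      (f p).1 < (f p).2 ∧ w (f p).2 < w (f p).1 ∧ f p ≠ (a, b) := by
    rintro ⟨i, j⟩ hij h
    simp only [Equiv.Perm.mul_apply] at hij h
    by_cases hlt : s i < s j
    · simp only [f, hlt, if_true, ne_eq, Prod.mk.injEq, h, true_and]
      rintro ⟨h₁, h₂⟩
      rw [← hss i, ← hss j, h₁, h₂, hsa, hsb] at hij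
      exact absurd hij hab.not_gt
    · simp only [f, hlt, if_false, ne_eq, Prod.mk.injEq, hij, true_and]
      rcases hcase i j hij hlt with ⟨rfl, rfl⟩ | ⟨rfl, h₁, h₂, h₃⟩ | ⟨rfl, h₁, h₂, h₃⟩
      · rw [hsa, hsb] at h
        exact absurd h hwab.not_gt
      · rw [hsa, h₃] at h
        exact ⟨h.trans hwab, fun h' => h₂.ne h'.2⟩
      · rw [hsb, h₃] at h
        exact ⟨hwab.trans h, fun h' => h₁.ne' h'.1⟩
  have hfrom : ∀ p : ℕ+ × ℕ+, p.1 < p.2 → w p.2 < w p.1 → p ≠ (a, b) →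
      (f p).1 < (f p).2 ∧ (w * s) (f p).2 < (w * s) (f p).1 := by
    rintro ⟨i, j⟩ hij h hne
    simp only at hij h
    by_cases hlt : s i < s j
    · simpa [f, hlt, hss] using h
    · simp only [f, hlt, if_false, hij, true_and, Equiv.Perm.mul_apply]
      rcases hcase i j hij hlt with ⟨rfl, rfl⟩ | ⟨rfl, h₁, h₂, h₃⟩ | ⟨rfl, h₁, h₂, h₃⟩
      · exact absurd rfl hne
      · rw [hsa, h₃]
        exact (hbtw' j h₁ h₂).resolve_right h.not_gt
      · rw [hsb, h₃]
        exact (hbtw' i h₁ h₂).resolve_left h.not_gt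
  rw [len, len, ← Set.ncard_sdiff_singleton_add_one hmem hw.finite_inversions_s2]
  congr 1
  refine Set.ncard_congr (fun p _ => f p) ?_ ?_ ?_
  · rintro p ⟨h₁, h₂⟩
    obtain ⟨h₃, h₄, h₅⟩ := hto p h₁ h₂
    exact ⟨⟨h₃, h₄⟩, h₅⟩
  · rintro p q ⟨hp, -⟩ ⟨hq, -⟩ h
    rw [← hff p hp, ← hff q hq, h]
  · rintro p ⟨⟨h₁, h₂⟩, h₃⟩
    exact ⟨f p, hfrom p h₁ h₂ h₃, hff p h₁⟩

/-- Theorem (correctness of the greedy algorithm step).  Suppose `u ≠ w` satisfy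
conditions (I) and (II).  Then (1) there is `a ≤ k` with `u a < w a`; for `a`
with `u a` minimal such, (2) there is `b > k` with `w b < w a ≤ u b`; for `b`
with `u b` maximal such, `ℓ(w(a,b)) = ℓ(w) - 1` (so `w(a,b) ⋖_k w`), and the
pair `(u, w(a,b))` again satisfies (I) and (II). -/
theorem stmt_2 (k : ℕ+) (u w : Equiv.Perm ℕ+) (hu : FinSupp u) (hw : FinSupp w)
    (hne : u ≠ w)
    (hI₁ : ∀ a : ℕ+, a ≤ k → u a ≤ w a) (hI₂ : ∀ b : ℕ+, k < b → w b ≤ u b)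
    (hII : ∀ a b : ℕ+, a < b → u a < u b → w b < w a → a ≤ k ∧ k < b) :
    (∃ a : ℕ+, a ≤ k ∧ u a < w a) ∧
    ∀ a : ℕ+, a ≤ k → u a < w a →
      (∀ a' : ℕ+, a' ≤ k → u a' < w a' → u a ≤ u a') →
      (∃ b : ℕ+, k < b ∧ w b < w a ∧ w a ≤ u b) ∧
      ∀ b : ℕ+, k < b → w b < w a → w a ≤ u b →
        (∀ b' : ℕ+, k < b' → w b' < w a → w a ≤ u b' → u b' ≤ u b) →
        (len (w * Equiv.swap a b) + 1 = len w ∧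
          kBruhatCov k (w * Equiv.swap a b) w ∧
          (∀ a' : ℕ+, a' ≤ k → u a' ≤ (w * Equiv.swap a b) a') ∧
          (∀ b' : ℕ+, k < b' → (w * Equiv.swap a b) b' ≤ u b') ∧
          (∀ a' b' : ℕ+, a' < b' → u a' < u b' →
            (w * Equiv.swap a b) b' < (w * Equiv.swap a b) a' → a' ≤ k ∧ k < b')) := by
  have hex : ∀ a, u a < w a → ∃ b, k < b ∧ w b < w a ∧ w a ≤ u b := fun a ha => by
    obtain ⟨b, hb₁, hb₂⟩ := exists_lt_of_lt w u ha le_rfl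
    exact ⟨b, lt_of_not_ge fun hbk => absurd (hI₁ b hbk) (hb₁.trans_le hb₂).not_ge, hb₁, hb₂⟩
  refine ⟨?_, fun a hak ha hmin => ⟨hex a ha, fun b hkb hba hab hmax => ?_⟩⟩
  · by_contra! h
    have hle : ∀ x, w x ≤ u x := fun x => (le_or_gt x k).elim (h x) (hI₂ x)
    obtain ⟨y, hy⟩ : ∃ y, w y < u y := by
      by_contra! h'
      exact hne (Equiv.ext fun x => le_antisymm (h' x) (hle x))
    obtain ⟨x, hx₁, hx₂⟩ := exists_lt_of_lt u w hy le_rfl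
    exact absurd (hle x) (hx₁.trans_le hx₂).not_ge
  have hfix : ∀ c, c ≤ k → u c < u a → w c = u c := fun c hc hca =>
    le_antisymm (not_lt.mp fun h => absurd (hmin c hc h) hca.not_ge) (hI₁ c hc)
  have hub : u a ≤ w b := by
    by_contra! hlt
    obtain ⟨x, hx₁, hx₂⟩ := exists_lt_of_lt u w hlt (ha.le.trans hab)
    have hxk : x ≤ k := le_of_not_gt fun h => absurd (hI₂ x h) (hx₁.trans_le hx₂).not_ge
    exact absurd (hfix x hxk hx₁) (hx₁.trans_le hx₂).ne'
  have hlt : a < b := hak.trans_lt hkb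
  have hlen : len (w * Equiv.swap a b) + 1 = len w := by
    refine len_mul_swap hw hlt hba fun c hac hcb hbc => ?_
    by_contra! hca
    rcases le_or_gt c k with hck | hkc
    · have hcu : u c < u a := by
        refine lt_of_le_of_ne (not_lt.mp fun h => ?_) fun h => hac.ne' (u.injective h)
        exact absurd (hII a c hac h hca).2 hck.not_gt
      rw [hfix c hck hcu] at hbc
      exact absurd hub (hbc.trans hcu).not_ge
    · have huc : u b < u c := by
        refine lt_of_le_of_ne (not_lt.mp fun h => ?_) fun h => hcb.ne' (u.injective h)
        exact absurd (hII c b hcb h hbc).1 hkc.not_ge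
      exact absurd (hmax c hkc hca (hab.trans huc.le)) huc.not_ge
  have hwa : (w * Equiv.swap a b) a = w b := by simp
  have hwb : (w * Equiv.swap a b) b = w a := by simp
  have hwx : ∀ x, x ≠ a → x ≠ b → (w * Equiv.swap a b) x = w x := fun x h₁ h₂ => by
    rw [Equiv.Perm.mul_apply, Equiv.swap_apply_of_ne_of_ne h₁ h₂]
  refine ⟨hlen, ⟨a, b, hak, hkb, by simp [mul_assoc], hlen.symm⟩, fun x hx => ?_, fun x hx => ?_,
    fun x y hxy huxy hwxy => ?_⟩
  · by_cases hxa : x = a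
    · rw [hxa, hwa]
      exact hub
    · rw [hwx x hxa (hx.trans_lt hkb).ne]
      exact hI₁ x hx
  · by_cases hxb : x = b
    · rw [hxb, hwb]
      exact hab
    · rw [hwx x (hak.trans_lt hx).ne' hxb]
      exact hI₂ x hx
  by_cases hxa : x = a
  · subst hxa
    by_cases hyb : y = b
    · exact ⟨hak, hyb ▸ hkb⟩
    · rw [hwa, hwx y hxy.ne' hyb] at hwxy
      exact hII x y hxy huxy (hwxy.trans hba)
  by_cases hxb : x = b
  · subst hxb
    rw [hwb, hwx y (hlt.trans hxy).ne' hxy.ne'] at hwxy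
    exact absurd (hmax y (hkb.trans hxy) hwxy (hab.trans huxy.le)) huxy.not_ge
  rw [hwx x hxa hxb] at hwxy
  by_cases hya : y = a
  · subst hya
    rw [hwa, hfix x (hxy.le.trans hak) huxy] at hwxy
    exact absurd hub (hwxy.trans huxy).not_ge
  by_cases hyb : y = b
  · subst hyb
    rw [hwb] at hwxy
    exact hII x y hxy huxy (hba.trans hwxy)
  rw [hwx y hya hyb] at hwxy
  exact hII x y hxy huxy hwxy
end
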